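/- Let (X,d,μ) be a metric measure space. The function d_ess: X×X → [0,∞] is an extended metric on X: d_ess(x,x)=0 for all x; d_ess(x,y) ≥ d(x,y) > 0 whenever x ≠ y; d_ess(x,y) = d_ess(y,x) for all x,y; and d_ess(a,b) ≤ d_ess(a,c) + d_ess(c,b) for all a,b,c ∈ X. -/

import Mathlib

open MeasureTheory
open scoped ENNReal

/-- A *curve* in a metric space `X`: a nonconstant continuous map from a compact
interval `[a,b] ⊆ ℝ` into `X`. -/
structure Curve (X : Type*) [MetricSpace X] where
  a : ℝ
  b : ℝ
  hab : a ≤ b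
  toFun : ℝ → X
  cont : ContinuousOn toFun (Set.Icc a b)
  nonconst : ∃ s ∈ Set.Icc a b, ∃ t ∈ Set.Icc a b, toFun s ≠ toFun t

namespace Curve

variable {X : Type*} [MetricSpace X]

/-- The length of a curve: the total variation of `γ` on `[a,b]`. -/
noncomputable def length (γ : Curve X) : ℝ≥0∞ :=
  eVariationOn γ.toFun (Set.Icc γ.a γ.b)

/-- A curve is rectifiable if it has finite length. -/
def Rectifiable (γ : Curve X) : Prop := γ.length ≠ ∞

/-- The length function `s_γ(t) = length (γ|_[a,t])`. -/
noncomputable def lenFun (γ : Curve X) (t : ℝ) : ℝ :=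
  (eVariationOn γ.toFun (Set.Icc γ.a t)).toReal

/-- The right inverse `s_γ⁻¹(t) = max {s ∈ [a,b] : s_γ(s) = t}` of the length function. -/
noncomputable def lenInv (γ : Curve X) (t : ℝ) : ℝ :=
  sSup {s | s ∈ Set.Icc γ.a γ.b ∧ γ.lenFun s = t}

/-- The arc-length parametrization `γ_s(t) = γ(s_γ⁻¹(t))`. -/
noncomputable def param (γ : Curve X) (t : ℝ) : X := γ.toFun (γ.lenInv t)

/-- The parameter domain `[0, length γ]` of the arc-length parametrization,
as a subset of `ℝ` (it is all of `[0,∞)` when `γ` has infinite length). -/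
def paramDomain (γ : Curve X) : Set ℝ := {t : ℝ | 0 ≤ t ∧ ENNReal.ofReal t ≤ γ.length}

/-- The line integral `∫_γ ρ ds = ∫_0^{length γ} ρ(γ_s(t)) dt` of a density `ρ` along `γ`. -/
noncomputable def lineIntegral (γ : Curve X) (ρ : X → ℝ≥0∞) : ℝ≥0∞ :=
  ∫⁻ t in γ.paramDomain, ρ (γ.param t)

/-- `σ` is a subcurve of `γ` if it is the restriction of `γ` to a subinterval. -/
def IsSubcurve (σ γ : Curve X) : Prop :=
  γ.a ≤ σ.a ∧ σ.b ≤ γ.b ∧ ∀ t ∈ Set.Icc σ.a σ.b, σ.toFun t = γ.toFun t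

/-- A curve is locally rectifiable if every interior point of its parameter interval has a
neighbourhood on which the curve is rectifiable. -/
def LocallyRectifiable (γ : Curve X) : Prop :=
  ∀ t ∈ Set.Ioo γ.a γ.b, ∃ u v : ℝ, u < t ∧ t < v ∧
    eVariationOn γ.toFun (Set.Icc (max γ.a u) (min γ.b v)) ≠ ∞

/-- A curve has positive length in a set `F`: `m₁(γ_s⁻¹(F)) > 0`. -/
def PosLength (γ : Curve X) (F : Set X) : Prop :=
  0 < volume (γ.paramDomain ∩ γ.param ⁻¹' F)

end Curve

section Modulus

variable {X : Type*} [MetricSpace X] [MeasurableSpace X] [BorelSpace X]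

/-- A density (nonnegative Borel function) `ρ` is admissible for a curve family `Γ`
if `∫_γ ρ ds ≥ 1` for every `γ ∈ Γ`. -/
def Admissible (Γ : Set (Curve X)) (ρ : X → ℝ≥0∞) : Prop :=
  Measurable ρ ∧ ∀ γ ∈ Γ, 1 ≤ γ.lineIntegral ρ

/-- The supremum-modulus `Mod_sup(Γ) = inf {sup_X ρ : ρ ∈ Adm(Γ)}`. -/
noncomputable def ModSup (Γ : Set (Curve X)) : ℝ≥0∞ :=
  ⨅ ρ ∈ {ρ : X → ℝ≥0∞ | Admissible Γ ρ}, ⨆ x, ρ x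

/-- `Mod_∞^*(Γ) = inf {‖ρ‖_∞ : ρ ∈ Adm(Γ)}`. -/
noncomputable def ModInfty (μ : Measure X) (Γ : Set (Curve X)) : ℝ≥0∞ :=
  ⨅ ρ ∈ {ρ : X → ℝ≥0∞ | Admissible Γ ρ}, essSup ρ μ

/-- A curve family is `∞`-exceptional if `Mod_∞^*(Γ) = 0`. -/
def Exceptional (μ : Measure X) (Γ : Set (Curve X)) : Prop :=
  ModInfty μ Γ = 0

/-- `ρ` is weakly admissible for `Γ` if `∫_γ ρ ds ≥ 1` for `∞`-a.e. curve `γ ∈ Γ`. -/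
def WeaklyAdmissible (μ : Measure X) (Γ : Set (Curve X)) (ρ : X → ℝ≥0∞) : Prop :=
  Measurable ρ ∧ Exceptional μ {γ ∈ Γ | γ.lineIntegral ρ < 1}

/-- The `∞`-modulus `Mod_∞(Γ) = inf {‖ρ‖_∞ : ρ weakly admissible for Γ}`. -/
noncomputable def ModInftyW (μ : Measure X) (Γ : Set (Curve X)) : ℝ≥0∞ :=
  ⨅ ρ ∈ {ρ : X → ℝ≥0∞ | WeaklyAdmissible μ Γ ρ}, essSup ρ μ

/-- The essential length `essℓ(Γ) = sup {a ≥ 0 : Γ(a) = {γ ∈ Γ : length γ < a} is ∞-exceptional}`. -/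
noncomputable def essLen (μ : Measure X) (Γ : Set (Curve X)) : ℝ≥0∞ :=
  sSup {a : ℝ≥0∞ | Exceptional μ {γ ∈ Γ | γ.length < a}}

/-- The family `Γ(x,y)` of rectifiable curves connecting `x` to `y`. -/
def ConnCurves (x y : X) : Set (Curve X) :=
  {γ : Curve X | γ.Rectifiable ∧ γ.toFun γ.a = x ∧ γ.toFun γ.b = y}

open scoped Classical in
/-- The essential metric `d_ess(x,y) = essℓ(Γ(x,y))` for `x ≠ y`, and `0` on the diagonal. -/
noncomputable def dEss (μ : Measure X) (x y : X) : ℝ≥0∞ :=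
  if x = y then 0 else essLen μ (ConnCurves x y)

end Modulus

open Set Filter Topology

namespace Curve

variable {X : Type*} [MetricSpace X]

theorem Rectifiable.eVariationOn_ne_top {γ : Curve X} (hγ : γ.Rectifiable) {s t : ℝ}
    (hs : γ.a ≤ s) (ht : t ≤ γ.b) : eVariationOn γ.toFun (Icc s t) ≠ ∞ :=
  ne_top_of_le_ne_top hγ (eVariationOn.mono _ (Icc_subset_Icc hs ht))

theorem Rectifiable.lenFun_add {γ : Curve X} (hγ : γ.Rectifiable) {s t : ℝ}
    (hs : γ.a ≤ s) (hst : s ≤ t) (ht : t ≤ γ.b) :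
    γ.lenFun t = γ.lenFun s + (eVariationOn γ.toFun (Icc s t)).toReal := by
  have h := eVariationOn.Icc_add_Icc γ.toFun hs hst (mem_univ s)
  simp only [univ_inter] at h
  rw [lenFun, lenFun, ← h, ENNReal.toReal_add (hγ.eVariationOn_ne_top le_rfl (hst.trans ht))
    (hγ.eVariationOn_ne_top hs ht)]

theorem lenFun_a (γ : Curve X) : γ.lenFun γ.a = 0 := by
  simp [lenFun]

theorem lenFun_b (γ : Curve X) : γ.lenFun γ.b = γ.length.toReal := rfl

/-- Points at the same arc-length position of a curve coincide. -/
theorem Rectifiable.toFun_eq_of_lenFun_eq {γ : Curve X} (hγ : γ.Rectifiable) {s t : ℝ}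
    (hs : s ∈ Icc γ.a γ.b) (ht : t ∈ Icc γ.a γ.b) (h : γ.lenFun s = γ.lenFun t) :
    γ.toFun s = γ.toFun t := by
  wlog hst : s ≤ t generalizing s t
  · exact (this ht hs h.symm (le_of_not_ge hst)).symm
  have h0 : (eVariationOn γ.toFun (Icc s t)).toReal = 0 := by
    linarith [hγ.lenFun_add hs.1 hst ht.2]
  rcases (ENNReal.toReal_eq_zero_iff _).1 h0 with h0 | h0
  · exact edist_le_zero.1 (h0 ▸ eVariationOn.edist_le _ (left_mem_Icc.2 hst) (right_mem_Icc.2 hst))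
  · exact absurd h0 (hγ.eVariationOn_ne_top hs.1 ht.2)

theorem Rectifiable.continuousOn_lenFun {γ : Curve X} (hγ : γ.Rectifiable) :
    ContinuousOn γ.lenFun (Icc γ.a γ.b) := by
  intro x hx
  have hbv : BoundedVariationOn γ.toFun (Icc γ.a γ.b) := hγ
  have hl := (ENNReal.tendsto_toReal ENNReal.zero_ne_top).comp
    (hbv.tendsto_eVariationOn_Icc_zero_left ((γ.cont x hx).mono inter_subset_left))
  have hr := (ENNReal.tendsto_toReal ENNReal.zero_ne_top).comp
    (hbv.tendsto_eVariationOn_Icc_zero_right x ((γ.cont x hx).mono inter_subset_left))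
  have h := hl.add hr
  simp only [ENNReal.toReal_zero, add_zero] at h
  refine tendsto_iff_dist_tendsto_zero.2
    (squeeze_zero' (Eventually.of_forall fun _ => dist_nonneg) ?_ h)
  filter_upwards [self_mem_nhdsWithin] with y hy
  simp only [Function.comp_apply]
  rcases le_total y x with hyx | hxy
  · rw [inter_eq_right.2 (Icc_subset_Icc hy.1 hx.2), hγ.lenFun_add hy.1 hyx hx.2,
      dist_self_add_right, Real.norm_of_nonneg ENNReal.toReal_nonneg]
    exact le_add_of_nonneg_right ENNReal.toReal_nonneg
  · rw [inter_eq_right.2 (Icc_subset_Icc hx.1 hy.2), hγ.lenFun_add hx.1 hxy hy.2,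
      dist_self_add_left, Real.norm_of_nonneg ENNReal.toReal_nonneg]
    exact le_add_of_nonneg_left ENNReal.toReal_nonneg

theorem Rectifiable.exists_lenFun_eq {γ : Curve X} (hγ : γ.Rectifiable) {t : ℝ}
    (ht : t ∈ Icc 0 γ.length.toReal) : ∃ s ∈ Icc γ.a γ.b, γ.lenFun s = t := by
  rw [← γ.lenFun_a, ← γ.lenFun_b] at ht
  exact intermediate_value_Icc γ.hab hγ.continuousOn_lenFun ht

theorem Rectifiable.param_lenFun {γ : Curve X} (hγ : γ.Rectifiable) {s : ℝ}
    (hs : s ∈ Icc γ.a γ.b) : γ.param (γ.lenFun s) = γ.toFun s := by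
  set S : Set ℝ := {u | u ∈ Icc γ.a γ.b ∧ γ.lenFun u = γ.lenFun s}
  have hne : S.Nonempty := ⟨s, hs, rfl⟩
  have hbdd : BddAbove S := ⟨γ.b, fun u hu => hu.1.2⟩
  have hcl : IsClosed S :=
    hγ.continuousOn_lenFun.preimage_isClosed_of_isClosed isClosed_Icc
      (isClosed_singleton (x := γ.lenFun s))
  obtain ⟨hm, he⟩ : sSup S ∈ S := hcl.csSup_mem hne hbdd
  exact hγ.toFun_eq_of_lenFun_eq hm hs he

theorem Rectifiable.paramDomain_eq {γ : Curve X} (hγ : γ.Rectifiable) :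
    γ.paramDomain = Icc 0 γ.length.toReal := by
  ext t
  exact and_congr_right fun _ => ENNReal.ofReal_le_iff_le_toReal hγ

/-- The curve traversed backwards. -/
def reverse (γ : Curve X) : Curve X where
  a := -γ.b
  b := -γ.a
  hab := neg_le_neg γ.hab
  toFun t := γ.toFun (-t)
  cont := γ.cont.comp continuous_neg.continuousOn fun t ht => ⟨le_neg.2 ht.2, neg_le.2 ht.1⟩
  nonconst := by
    obtain ⟨s, hs, t, ht, h⟩ := γ.nonconst
    exact ⟨-s, ⟨neg_le_neg hs.2, neg_le_neg hs.1⟩, -t, ⟨neg_le_neg ht.2, neg_le_neg ht.1⟩,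
      by simpa using h⟩

theorem eVariationOn_reverse (γ : Curve X) (s t : ℝ) :
    eVariationOn γ.reverse.toFun (Icc (-t) (-s)) = eVariationOn γ.toFun (Icc s t) := by
  have h := eVariationOn.comp_eq_of_antitoneOn γ.toFun (fun u : ℝ => -u)
    (t := Icc (-t) (-s)) fun u _ v _ huv => neg_le_neg huv
  rw [image_neg_Icc, neg_neg, neg_neg] at h
  exact h

theorem length_reverse (γ : Curve X) : γ.reverse.length = γ.length :=
  γ.eVariationOn_reverse γ.a γ.b

theorem Rectifiable.reverse {γ : Curve X} (hγ : γ.Rectifiable) : γ.reverse.Rectifiable := by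
  rwa [Rectifiable, length_reverse]

theorem Rectifiable.lineIntegral_reverse {γ : Curve X} (hγ : γ.Rectifiable) (ρ : X → ℝ≥0∞) :
    γ.reverse.lineIntegral ρ = γ.lineIntegral ρ := by
  rw [lineIntegral, lineIntegral, hγ.reverse.paramDomain_eq, hγ.paramDomain_eq, length_reverse]
  set L := γ.length.toReal with hL
  have himg : (fun t => L - t) '' Icc 0 L = Icc 0 L := by simp
  conv_lhs => rw [← himg]
  rw [← (volume.measurePreserving_sub_left L).setLIntegral_comp_emb
    (MeasurableEquiv.subLeft L).measurableEmbedding]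
  refine setLIntegral_congr_fun measurableSet_Icc fun t ht => ?_
  obtain ⟨s, hs, rfl⟩ := hγ.exists_lenFun_eq ht
  have hs' : -s ∈ Icc γ.reverse.a γ.reverse.b := ⟨neg_le_neg hs.2, neg_le_neg hs.1⟩
  have hlen : L - γ.lenFun s = γ.reverse.lenFun (-s) := by
    have h : γ.reverse.lenFun (-s) = (eVariationOn γ.toFun (Icc s γ.b)).toReal :=
      congrArg ENNReal.toReal (γ.eVariationOn_reverse s γ.b)
    rw [h, hL, ← lenFun_b, hγ.lenFun_add hs.1 hs.2 le_rfl, add_sub_cancel_left]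
  simp only [hlen, hγ.reverse.param_lenFun hs', hγ.param_lenFun hs]
  simp [Curve.reverse]

/-- The underlying map of the concatenation of two curves. -/
noncomputable def concatFun (γ σ : Curve X) (t : ℝ) : X :=
  if t ≤ γ.b then γ.toFun t else σ.toFun (t - (γ.b - σ.a))

theorem concatFun_eqOn_left (γ σ : Curve X) : EqOn (concatFun γ σ) γ.toFun (Iic γ.b) :=
  fun _ ht => if_pos ht

theorem concatFun_eqOn_right {γ σ : Curve X} (h : γ.toFun γ.b = σ.toFun σ.a) :
    EqOn (concatFun γ σ) (fun t => σ.toFun (t - (γ.b - σ.a))) (Ici γ.b) := by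
  intro t ht
  rcases eq_or_lt_of_le (mem_Ici.1 ht) with rfl | ht
  · simp [concatFun, h]
  · exact if_neg (not_le.2 ht)

theorem continuousOn_concatFun {γ σ : Curve X} (h : γ.toFun γ.b = σ.toFun σ.a) :
    ContinuousOn (concatFun γ σ) (Icc γ.a (γ.b + (σ.b - σ.a))) := by
  rw [← Icc_union_Icc_eq_Icc γ.hab (le_add_of_nonneg_right (sub_nonneg.2 σ.hab))]
  refine ContinuousOn.union_of_isClosed
    (γ.cont.congr ((concatFun_eqOn_left γ σ).mono Icc_subset_Iic_self))
    (ContinuousOn.congr ?_ ((concatFun_eqOn_right h).mono Icc_subset_Ici_self))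
    isClosed_Icc isClosed_Icc
  refine σ.cont.comp (by fun_prop) fun t ht => ?_
  constructor <;> linarith [ht.1, ht.2]

/-- The concatenation of two curves. -/
noncomputable def concat (γ σ : Curve X) (h : γ.toFun γ.b = σ.toFun σ.a) : Curve X where
  a := γ.a
  b := γ.b + (σ.b - σ.a)
  hab := γ.hab.trans (le_add_of_nonneg_right (sub_nonneg.2 σ.hab))
  toFun := concatFun γ σ
  cont := continuousOn_concatFun h
  nonconst := by
    have hb : γ.b ≤ γ.b + (σ.b - σ.a) := le_add_of_nonneg_right (sub_nonneg.2 σ.hab)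
    obtain ⟨s, hs, t, ht, hst⟩ := γ.nonconst
    refine ⟨s, ⟨hs.1, hs.2.trans hb⟩, t, ⟨ht.1, ht.2.trans hb⟩, ?_⟩
    rwa [concatFun_eqOn_left γ σ hs.2, concatFun_eqOn_left γ σ ht.2]

variable {γ σ : Curve X} (h : γ.toFun γ.b = σ.toFun σ.a)

theorem eVariationOn_concat_left {t : ℝ} (ht : t ≤ γ.b) :
    eVariationOn (concat γ σ h).toFun (Icc γ.a t) = eVariationOn γ.toFun (Icc γ.a t) :=
  eVariationOn.congr ((concatFun_eqOn_left γ σ).mono fun _ hu => hu.2.trans ht)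

theorem concat_toFun_add {u : ℝ} (hu : σ.a ≤ u) :
    (concat γ σ h).toFun (u + (γ.b - σ.a)) = σ.toFun u := by
  have hmem : u + (γ.b - σ.a) ∈ Ici γ.b := by rw [mem_Ici]; linarith
  simpa [concat] using concatFun_eqOn_right h hmem

theorem eVariationOn_concat_right (t : ℝ) :
    eVariationOn (concat γ σ h).toFun (Icc γ.b (t + (γ.b - σ.a))) =
      eVariationOn σ.toFun (Icc σ.a t) := by
  have hcomp := eVariationOn.comp_eq_of_monotoneOn (concat γ σ h).toFun
    (fun u : ℝ => u + (γ.b - σ.a)) (t := Icc σ.a t) fun u _ v _ huv => add_le_add_left huv _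
  rw [image_add_const_Icc, add_sub_cancel] at hcomp
  rw [← hcomp]
  exact eVariationOn.congr fun u hu => concat_toFun_add h hu.1

theorem eVariationOn_concat_add {t : ℝ} (ht : σ.a ≤ t) :
    eVariationOn (concat γ σ h).toFun (Icc γ.a (t + (γ.b - σ.a))) =
      γ.length + eVariationOn σ.toFun (Icc σ.a t) := by
  have hadd := eVariationOn.Icc_add_Icc (concat γ σ h).toFun γ.hab
    (show γ.b ≤ t + (γ.b - σ.a) by linarith) (mem_univ _)
  simp only [univ_inter] at hadd
  rw [← hadd, eVariationOn_concat_left h le_rfl, eVariationOn_concat_right, length]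

theorem concat_b : (concat γ σ h).b = σ.b + (γ.b - σ.a) := by
  simp only [concat]; ring

theorem length_concat : (concat γ σ h).length = γ.length + σ.length := by
  rw [length, concat_b]
  exact eVariationOn_concat_add h σ.hab

theorem Rectifiable.concat (hγ : γ.Rectifiable) (hσ : σ.Rectifiable) :
    (concat γ σ h).Rectifiable := by
  rw [Rectifiable, length_concat]
  exact ENNReal.add_ne_top.2 ⟨hγ, hσ⟩

theorem lineIntegral_concat_le (hγ : γ.Rectifiable) (hσ : σ.Rectifiable) (ρ : X → ℝ≥0∞) :
    (concat γ σ h).lineIntegral ρ ≤ γ.lineIntegral ρ + σ.lineIntegral ρ := by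
  have hr := hγ.concat h hσ
  rw [lineIntegral, lineIntegral, lineIntegral, hr.paramDomain_eq, hγ.paramDomain_eq,
    hσ.paramDomain_eq, length_concat, ENNReal.toReal_add hγ hσ,
    ← Icc_union_Icc_eq_Icc (b := γ.length.toReal) ENNReal.toReal_nonneg
      (le_add_of_nonneg_right ENNReal.toReal_nonneg)]
  refine (lintegral_union_le _ _ _).trans (add_le_add (le_of_eq ?_) (le_of_eq ?_))
  · refine setLIntegral_congr_fun measurableSet_Icc fun t ht => ?_
    obtain ⟨s, hs, rfl⟩ := hγ.exists_lenFun_eq ht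
    have hs' : s ∈ Icc (Curve.concat γ σ h).a (Curve.concat γ σ h).b :=
      ⟨hs.1, hs.2.trans (le_add_of_nonneg_right (sub_nonneg.2 σ.hab))⟩
    have hlen : γ.lenFun s = (Curve.concat γ σ h).lenFun s :=
      congrArg ENNReal.toReal (eVariationOn_concat_left h hs.2).symm
    simp only [hγ.param_lenFun hs]
    rw [hlen, hr.param_lenFun hs']
    exact congrArg ρ (concatFun_eqOn_left γ σ hs.2)
  · have himg : (fun t => γ.length.toReal + t) '' Icc 0 σ.length.toReal =
        Icc γ.length.toReal (γ.length.toReal + σ.length.toReal) := by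
      simp [add_comm]
    rw [← himg, ← (measurePreserving_add_left volume _).setLIntegral_comp_emb
      (measurableEmbedding_addLeft _)]
    refine setLIntegral_congr_fun measurableSet_Icc fun t ht => ?_
    obtain ⟨s, hs, rfl⟩ := hσ.exists_lenFun_eq ht
    have hs' : s + (γ.b - σ.a) ∈ Icc (Curve.concat γ σ h).a (Curve.concat γ σ h).b := by
      rw [concat_b]
      exact ⟨show γ.a ≤ _ by linarith [hs.1, γ.hab], by linarith [hs.2]⟩
    have hlen : γ.length.toReal + σ.lenFun s =
        (Curve.concat γ σ h).lenFun (s + (γ.b - σ.a)) := by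
      rw [lenFun, lenFun, ← ENNReal.toReal_add hγ (hσ.eVariationOn_ne_top le_rfl hs.2),
        ← eVariationOn_concat_add h hs.1]
      rfl
    simp only [hlen, hr.param_lenFun hs', hσ.param_lenFun hs, concat_toFun_add h hs.1]

theorem edist_le_length (γ : Curve X) : edist (γ.toFun γ.a) (γ.toFun γ.b) ≤ γ.length :=
  eVariationOn.edist_le _ (left_mem_Icc.2 γ.hab) (right_mem_Icc.2 γ.hab)

end Curve

section Modulus

variable {X : Type*} [MetricSpace X] [MeasurableSpace X]

theorem modInfty_le_of_forall_exists (μ : Measure X) {Γ Γ' : Set (Curve X)}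
    (h : ∀ γ ∈ Γ', ∃ σ ∈ Γ, ∀ ρ : X → ℝ≥0∞, σ.lineIntegral ρ ≤ γ.lineIntegral ρ) :
    ModInfty μ Γ' ≤ ModInfty μ Γ := by
  refine biInf_mono fun ρ hρ => ⟨hρ.1, fun γ hγ => ?_⟩
  obtain ⟨σ, hσ, hle⟩ := h γ hγ
  exact (hρ.2 σ hσ).trans (hle ρ)

theorem exceptional_empty (μ : Measure X) : Exceptional μ (∅ : Set (Curve X)) := by
  refine le_antisymm ((iInf₂_le (fun _ => 0) ⟨measurable_const, by simp⟩).trans ?_) zero_le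
  exact essSup_le_of_ae_le 0 (Eventually.of_forall fun _ => le_rfl)

/-- If every curve in `Γ₁` can be joined with every curve in `Γ₂` to form a curve in the
exceptional family `Γ`, then `Γ₁` or `Γ₂` is exceptional. -/
theorem Exceptional.of_concat {μ : Measure X} {Γ Γ₁ Γ₂ : Set (Curve X)} (hΓ : Exceptional μ Γ)
    (h : ∀ γ ∈ Γ₁, ∀ σ ∈ Γ₂, ∃ τ ∈ Γ, ∀ ρ : X → ℝ≥0∞,
      τ.lineIntegral ρ ≤ γ.lineIntegral ρ + σ.lineIntegral ρ) :
    Exceptional μ Γ₁ ∨ Exceptional μ Γ₂ := by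
  have key : min (ModInfty μ Γ₁) (ModInfty μ Γ₂) ≤ 2 * ModInfty μ Γ := by
    rw [ModInfty, ModInfty, ModInfty, ENNReal.mul_iInf_of_ne two_ne_zero ENNReal.ofNat_ne_top]
    refine le_iInf fun ρ => ?_
    rw [ENNReal.mul_iInf_of_ne two_ne_zero ENNReal.ofNat_ne_top]
    refine le_iInf fun hρ => ?_
    rw [← ENNReal.essSup_const_mul]
    have hint (γ : Curve X) :
        γ.lineIntegral (fun x => 2 * ρ x) = 2 * γ.lineIntegral ρ :=
      lintegral_const_mul' _ _ ENNReal.ofNat_ne_top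
    by_cases h₁ : ∀ γ ∈ Γ₁, 1 ≤ γ.lineIntegral fun x => 2 * ρ x
    · exact (min_le_left _ _).trans (iInf₂_le _ ⟨hρ.1.const_mul 2, h₁⟩)
    · refine (min_le_right _ _).trans (iInf₂_le _ ⟨hρ.1.const_mul 2, fun σ hσ => ?_⟩)
      push Not at h₁
      obtain ⟨γ, hγ, hlt⟩ := h₁
      obtain ⟨τ, hτ, hle⟩ := h γ hγ σ hσ
      rw [hint] at hlt ⊢
      by_contra! hlt'
      have h2 : 2 * τ.lineIntegral ρ < 1 + 1 := by
        refine lt_of_le_of_lt ?_ (ENNReal.add_lt_add hlt hlt')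
        rw [← mul_add]
        gcongr
        exact hle ρ
      refine h2.not_ge ?_
      rw [one_add_one_eq_two]
      exact le_mul_of_one_le_right' (hρ.2 τ hτ)
  rw [show ModInfty μ Γ = 0 from hΓ, mul_zero, nonpos_iff_eq_zero] at key
  exact min_eq_bot.1 key

theorem edist_le_essLen_connCurves (μ : Measure X) (x y : X) :
    edist x y ≤ essLen μ (ConnCurves x y) := by
  refine le_sSup ?_
  have hempty : {γ ∈ ConnCurves x y | γ.length < edist x y} = ∅ := by
    refine eq_empty_of_forall_notMem fun γ hγ => ?_
    obtain ⟨⟨-, rfl, rfl⟩, hlt⟩ := hγ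
    exact hlt.not_ge γ.edist_le_length
  rw [mem_ofPred_eq, hempty]
  exact exceptional_empty μ

theorem essLen_connCurves_le_swap (μ : Measure X) (x y : X) :
    essLen μ (ConnCurves x y) ≤ essLen μ (ConnCurves y x) := by
  refine sSup_le_sSup fun l hl => ?_
  refine le_antisymm ((modInfty_le_of_forall_exists μ ?_).trans hl.le) zero_le
  rintro γ ⟨⟨hγ, hx, hy⟩, hlt⟩
  refine ⟨γ.reverse, ⟨⟨hγ.reverse, ?_, ?_⟩, ?_⟩, fun ρ => (hγ.lineIntegral_reverse ρ).le⟩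
  · simpa [Curve.reverse] using hy
  · simpa [Curve.reverse] using hx
  · rwa [Curve.length_reverse]

theorem essLen_connCurves_triangle (μ : Measure X) (a b c : X) :
    essLen μ (ConnCurves a b) ≤ essLen μ (ConnCurves a c) + essLen μ (ConnCurves c b) := by
  refine sSup_le fun l hl => ?_
  by_contra! hlt
  obtain ⟨u, hu, v, hv, huv⟩ := ENNReal.exists_add_lt_of_add_lt hlt
  have hor : Exceptional μ {γ ∈ ConnCurves a c | γ.length < u} ∨
      Exceptional μ {γ ∈ ConnCurves c b | γ.length < v} := by
    refine Exceptional.of_concat hl ?_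
    rintro γ ⟨⟨hγ, hγa, hγb⟩, hγl⟩ σ ⟨⟨hσ, hσa, hσb⟩, hσl⟩
    have h : γ.toFun γ.b = σ.toFun σ.a := hγb.trans hσa.symm
    refine ⟨γ.concat σ h, ⟨⟨hγ.concat h hσ, ?_, ?_⟩, ?_⟩, Curve.lineIntegral_concat_le h hγ hσ⟩
    · exact (Curve.concatFun_eqOn_left γ σ γ.hab).trans hγa
    · rw [Curve.concat_b, Curve.concat_toFun_add h σ.hab, hσb]
    · rw [Curve.length_concat]
      exact (ENNReal.add_lt_add hγl hσl).trans huv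
  rcases hor with h | h
  · exact hu.not_ge (le_sSup h)
  · exact hv.not_ge (le_sSup h)

end Modulus

/-- The essential metric `d_ess` is an extended metric on `X`: it vanishes on the diagonal,
satisfies `d_ess(x,y) ≥ d(x,y) > 0` for `x ≠ y`, is symmetric, and satisfies the triangle
inequality. -/
theorem dEss_extended_metric {X : Type*} [MetricSpace X] [TopologicalSpace.SeparableSpace X]
    [MeasurableSpace X] [BorelSpace X] (μ : Measure X)
    (hμ : ∀ x : X, ∃ r > 0, 0 < μ (Metric.ball x r) ∧ μ (Metric.ball x r) < ∞) :
    (∀ x : X, dEss μ x x = 0) ∧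
    (∀ x y : X, x ≠ y → 0 < edist x y ∧ edist x y ≤ dEss μ x y) ∧
    (∀ x y : X, dEss μ x y = dEss μ y x) ∧
    (∀ a b c : X, dEss μ a b ≤ dEss μ a c + dEss μ c b) := by
  refine ⟨fun x => if_pos rfl, fun x y hxy => ⟨edist_pos.2 hxy, ?_⟩, fun x y => ?_,
    fun a b c => ?_⟩
  · rw [dEss, if_neg hxy]
    exact edist_le_essLen_connCurves μ x y
  · rcases eq_or_ne x y with rfl | hxy
    · rfl
    · rw [dEss, dEss, if_neg hxy, if_neg hxy.symm]
      exact le_antisymm (essLen_connCurves_le_swap μ x y) (essLen_connCurves_le_swap μ y x)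
  · rcases eq_or_ne a b with rfl | hab
    · simp [dEss]
    rcases eq_or_ne a c with rfl | hac
    · simp [dEss]
    rcases eq_or_ne c b with rfl | hcb
    · simp [dEss]
    rw [dEss, dEss, dEss, if_neg hab, if_neg hac, if_neg hcb]
    exact essLen_connCurves_triangle μ a b c
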